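/- Let ε ∈ ℤ/pℤ be a nonsquare. Let H₁ and H₂ be subgroups of GL₂(ℤ/p²ℤ) such that for each i = 1, 2 every element of φ(Hᵢ) is of the form !![w, ε·y; y, w] for some w, y ∈ ℤ/pℤ, and φ(Hᵢ) contains at least one element with y ≠ 0 (i.e. φ(Hᵢ) is not contained in the scalar matrices). If H₁ and H₂ are locally conjugate in GL₂(ℤ/p²ℤ), then they are conjugate in GL₂(ℤ/p²ℤ). -/

import Mathlib

open Matrix

/-- `GL₂(ℤ/nℤ)`. -/
abbrev GL2 (n : ℕ) : Type := GL (Fin 2) (ZMod n)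

/-- Reduction modulo `p` from `ℤ/p²ℤ` to `ℤ/pℤ`. -/
def red (p : ℕ) : ZMod (p^2) →+* ZMod p :=
  ZMod.castHom (dvd_pow_self p (by norm_num)) (ZMod p)

/-- The natural homomorphism `φ : GL₂(ℤ/p²ℤ) →* GL₂(ℤ/pℤ)` given by entrywise
reduction modulo `p`. -/
def phi (p : ℕ) : GL2 (p^2) →* GL2 p :=
  Matrix.GeneralLinearGroup.map (red p)

/-- The element `1 + p • A` of `GL₂(ℤ/p²ℤ)` (its inverse is `1 - p • A`). -/
def kerUnit {p : ℕ} (A : Matrix (Fin 2) (Fin 2) (ZMod (p^2))) : GL2 (p^2) where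
  val := 1 + (p : ZMod (p^2)) • A
  inv := 1 - (p : ZMod (p^2)) • A
  val_inv := by
    have h : ((p : ZMod (p^2)) • A) * ((p : ZMod (p^2)) • A) = 0 := by
      rw [smul_mul_assoc, mul_smul_comm, smul_smul, ← Nat.cast_mul, ← pow_two,
        ZMod.natCast_self, zero_smul]
    rw [add_mul, one_mul, mul_sub, mul_one, h, sub_zero]
    abel
  inv_val := by
    have h : ((p : ZMod (p^2)) • A) * ((p : ZMod (p^2)) • A) = 0 := by
      rw [smul_mul_assoc, mul_smul_comm, smul_smul, ← Nat.cast_mul, ← pow_two,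
        ZMod.natCast_self, zero_smul]
    rw [sub_mul, one_mul, mul_add, mul_one, h, add_zero]
    abel

/-- The antidiagonal swap matrix `!![0,1;1,0]` as an element of `GL₂(ℤ/p²ℤ)`. -/
def swapGL (p : ℕ) : GL2 (p^2) where
  val := !![0, 1; 1, 0]
  inv := !![0, 1; 1, 0]
  val_inv := by
    ext i j
    fin_cases i <;> fin_cases j <;>
      simp [Matrix.mul_apply, Fin.sum_univ_succ, Matrix.one_apply]
  inv_val := by
    ext i j
    fin_cases i <;> fin_cases j <;>
      simp [Matrix.mul_apply, Fin.sum_univ_succ, Matrix.one_apply]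

/-- Subgroups `H₁` and `H₂` of a group `G` are locally conjugate in `G` if there is a
bijection `f : H₁ → H₂` such that `h` and `f h` are conjugate in `G` for every `h ∈ H₁`. -/
def IsLocallyConjugate {G : Type*} [Group G] (H₁ H₂ : Subgroup G) : Prop :=
  ∃ f : H₁ ≃ H₂, ∀ h : H₁, IsConj (h : G) ((f h : G))

/-- Subgroups `H₁` and `H₂` of `G` are conjugate in `G`: `g H₁ g⁻¹ = H₂` for some `g`. -/
def IsConjugateSubgroup {G : Type*} [Group G] (H₁ H₂ : Subgroup G) : Prop :=
  ∃ g : G, Subgroup.map (MulAut.conj g).toMonoidHom H₁ = H₂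

/-- Nontrivially locally conjugate: locally conjugate but not conjugate. -/
def IsNontriviallyLocallyConjugate {G : Type*} [Group G] (H₁ H₂ : Subgroup G) : Prop :=
  IsLocallyConjugate H₁ H₂ ∧ ¬ IsConjugateSubgroup H₁ H₂

section Reduction

variable {p : ℕ}

/-- The additive map `ℤ/pℤ → ℤ/p²ℤ` induced by multiplication by `p`. -/
def mulP (p : ℕ) : ZMod p →+ ZMod (p^2) :=
  ZMod.lift p ⟨(Int.castAddHom (ZMod (p^2))).comp (AddMonoidHom.mulLeft (p : ℤ)), by
    have h : ((p ^ 2 : ℕ) : ZMod (p^2)) = 0 := ZMod.natCast_self _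
    simpa [pow_two] using h⟩

lemma red_surjective (p : ℕ) : Function.Surjective (red p) :=
  ZMod.castHom_surjective _

lemma mulP_red (x : ZMod (p^2)) : mulP p (red p x) = p * x := by
  obtain ⟨n, rfl⟩ := ZMod.intCast_surjective x
  rw [map_intCast, mulP, ZMod.lift_coe]
  simp

lemma mulP_mul (x : ZMod p) (y : ZMod (p^2)) : mulP p x * y = mulP p (x * red p y) := by
  obtain ⟨x, rfl⟩ := red_surjective p x
  rw [← map_mul, mulP_red, mulP_red, mul_assoc]

lemma mul_mulP (x : ZMod p) (y : ZMod (p^2)) : y * mulP p x = mulP p (red p y * x) := by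
  rw [mul_comm, mulP_mul, mul_comm]

@[simp] lemma red_mulP (x : ZMod p) : red p (mulP p x) = 0 := by
  obtain ⟨x, rfl⟩ := red_surjective p x
  rw [mulP_red, map_mul, map_natCast, ZMod.natCast_self, zero_mul]

lemma mulP_injective [Fact p.Prime] : Function.Injective (mulP p) := by
  rw [injective_iff_map_eq_zero]
  intro x hx
  obtain ⟨n, rfl⟩ := ZMod.intCast_surjective x
  rw [mulP, ZMod.lift_coe] at hx
  have h : (((p : ℤ) * n : ℤ) : ZMod (p^2)) = 0 := by simpa using hx
  rw [ZMod.intCast_zmod_eq_zero_iff_dvd] at h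
  rw [ZMod.intCast_zmod_eq_zero_iff_dvd]
  have hp : (p : ℤ) ≠ 0 := by exact_mod_cast (Fact.out : p.Prime).ne_zero
  rw [Nat.cast_pow, pow_two] at h
  exact (mul_dvd_mul_iff_left hp).1 h

lemma exists_eq_mulP {x : ZMod (p^2)} (hx : red p x = 0) : ∃ z, x = mulP p z := by
  obtain ⟨n, rfl⟩ := ZMod.intCast_surjective x
  rw [map_intCast, ZMod.intCast_zmod_eq_zero_iff_dvd] at hx
  obtain ⟨m, rfl⟩ := hx
  exact ⟨red p m, by rw [mulP_red]; push_cast; rfl⟩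

lemma isUnit_of_red_ne_zero [Fact p.Prime] {x : ZMod (p^2)} (hx : red p x ≠ 0) : IsUnit x := by
  obtain ⟨y, hy⟩ := red_surjective p (red p x)⁻¹
  obtain ⟨z, hz⟩ := exists_eq_mulP (x := x * y - 1)
    (by rw [map_sub, map_mul, hy, map_one, mul_inv_cancel₀ hx, sub_self])
  have h0 : mulP p z * mulP p z = 0 := by rw [mulP_mul, red_mulP, mul_zero, map_zero]
  refine IsUnit.of_mul_eq_one (y * (1 - mulP p z)) ?_
  rw [← mul_assoc, eq_add_of_sub_eq hz]
  linear_combination -h0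

/-- Lifts of invertible matrices are invertible. -/
lemma exists_lift [Fact p.Prime] (M : Matrix (Fin 2) (Fin 2) (ZMod (p^2)))
    (t : GL2 p) (h : M.map (red p) = t.val) :
    ∃ g : GL2 (p^2), (g : Matrix _ _ _) = M ∧ phi p g = t := by
  have hd : IsUnit M.det := by
    apply isUnit_of_red_ne_zero
    have h1 : red p M.det = (M.map (red p)).det := RingHom.map_det _ _
    rw [h1, h]
    exact ((Matrix.isUnit_iff_isUnit_det _).1 t.isUnit).ne_zero
  refine ⟨Matrix.GeneralLinearGroup.mk'' M hd, rfl, ?_⟩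
  ext i j
  rw [← h]
  rfl

lemma map_mulP_mul (A : Matrix (Fin 2) (Fin 2) (ZMod p)) (M : Matrix (Fin 2) (Fin 2) (ZMod (p^2))) :
    A.map (mulP p) * M = (A * M.map (red p)).map (mulP p) := by
  ext i j
  simp [Matrix.mul_apply, mulP_mul]

lemma mul_map_mulP (A : Matrix (Fin 2) (Fin 2) (ZMod p)) (M : Matrix (Fin 2) (Fin 2) (ZMod (p^2))) :
    M * A.map (mulP p) = (M.map (red p) * A).map (mulP p) := by
  ext i j
  simp [Matrix.mul_apply, mul_mulP]

lemma map_mulP_mul_map_mulP (A B : Matrix (Fin 2) (Fin 2) (ZMod p)) :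
    A.map (mulP p) * B.map (mulP p) = 0 := by
  rw [map_mulP_mul]
  have : (B.map (mulP p)).map (red p) = 0 := by ext i j; simp
  rw [this, mul_zero]
  ext i j; simp

/-- The isomorphism `A ↦ 1 + pA` of `M₂(ℤ/pℤ)` with the kernel of `φ`. -/
def kerHom (p : ℕ) : Multiplicative (Matrix (Fin 2) (Fin 2) (ZMod p)) →* GL2 (p^2) :=
  MonoidHom.toHomUnits
    { toFun := fun A => 1 + A.toAdd.map (mulP p)
      map_one' := by ext i j; simp
      map_mul' := fun A B => by
        rw [add_mul, mul_add, mul_add, map_mulP_mul_map_mulP, toAdd_mul,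
          Matrix.map_add _ (map_add _)]
        simp only [mul_one, one_mul, add_zero]
        abel }

/-- The element `1 + pA` of `GL₂(ℤ/p²ℤ)`, for `A` a matrix modulo `p`. -/
def kerElt (A : Matrix (Fin 2) (Fin 2) (ZMod p)) : GL2 (p^2) := kerHom p (Multiplicative.ofAdd A)

lemma coe_kerElt (A : Matrix (Fin 2) (Fin 2) (ZMod p)) :
    (kerElt A : Matrix (Fin 2) (Fin 2) (ZMod (p^2))) = 1 + A.map (mulP p) := rfl

lemma kerElt_add (A B : Matrix (Fin 2) (Fin 2) (ZMod p)) :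
    kerElt (A + B) = kerElt A * kerElt B := by
  simp only [kerElt, ofAdd_add, map_mul]

@[simp] lemma kerElt_zero : kerElt (0 : Matrix (Fin 2) (Fin 2) (ZMod p)) = 1 := by
  simp only [kerElt, ofAdd_zero, map_one]

lemma kerElt_neg (A : Matrix (Fin 2) (Fin 2) (ZMod p)) : kerElt (-A) = (kerElt A)⁻¹ := by
  simp only [kerElt, ofAdd_neg, map_inv]

lemma kerElt_pow (A : Matrix (Fin 2) (Fin 2) (ZMod p)) : kerElt A ^ p = 1 := by
  rw [kerElt, ← map_pow, ← ofAdd_nsmul]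
  have : p • A = 0 := by ext i j; simp
  rw [this, ofAdd_zero, map_one]

lemma kerElt_injective [Fact p.Prime] :
    Function.Injective (kerElt : Matrix (Fin 2) (Fin 2) (ZMod p) → GL2 (p^2)) := by
  intro A B h
  have h1 := congrArg (fun g : GL2 (p^2) => (g : Matrix (Fin 2) (Fin 2) (ZMod (p^2)))) h
  simp only [coe_kerElt, add_right_inj] at h1
  ext i j
  exact mulP_injective (congrFun (congrFun h1 i) j)

lemma coe_phi (g : GL2 (p^2)) :
    (phi p g : Matrix (Fin 2) (Fin 2) (ZMod p)) = (g : Matrix _ _ _).map (red p) := rfl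

@[simp] lemma phi_kerElt (A : Matrix (Fin 2) (Fin 2) (ZMod p)) : phi p (kerElt A) = 1 := by
  ext i j
  rw [coe_phi, coe_kerElt]
  by_cases h : i = j <;> simp [h]

lemma exists_eq_kerElt {g : GL2 (p^2)} (hg : phi p g = 1) : ∃ A, g = kerElt A := by
  have h (i j) : ∃ z, (g : Matrix (Fin 2) (Fin 2) (ZMod (p^2))) i j
      - (1 : Matrix (Fin 2) (Fin 2) (ZMod (p^2))) i j = mulP p z := by
    apply exists_eq_mulP
    have h1 := congrArg (fun t : GL2 p => (t : Matrix (Fin 2) (Fin 2) (ZMod p)) i j) hg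
    simp only [coe_phi, Matrix.map_apply] at h1
    rw [map_sub, h1]
    by_cases h : i = j
    · subst h; simp
    · simp [h]
  choose A hA using h
  refine ⟨Matrix.of A, ?_⟩
  ext i j
  rw [coe_kerElt, Matrix.add_apply, Matrix.map_apply, Matrix.of_apply, ← hA]
  ring

lemma exists_eq_mul_kerElt {g g' : GL2 (p^2)} (h : phi p g = phi p g') :
    ∃ A, g = g' * kerElt A := by
  obtain ⟨A, hA⟩ := exists_eq_kerElt (g := g'⁻¹ * g) (by rw [map_mul, map_inv, h, inv_mul_cancel])
  exact ⟨A, by rw [← hA, mul_inv_cancel_left]⟩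

lemma mul_kerElt_of_eq (g : GL2 (p^2)) {A B : Matrix (Fin 2) (Fin 2) (ZMod p)}
    (h : (phi p g : Matrix _ _ _) * A = B * (phi p g : Matrix _ _ _)) :
    g * kerElt A = kerElt B * g := by
  ext i j
  rw [Matrix.GeneralLinearGroup.coe_mul, Matrix.GeneralLinearGroup.coe_mul, coe_kerElt, coe_kerElt,
    mul_add, add_mul, mul_one, one_mul, mul_map_mulP, map_mulP_mul, ← coe_phi, h]

lemma conj_kerElt (g : GL2 (p^2)) (A : Matrix (Fin 2) (Fin 2) (ZMod p)) :
    g * kerElt A * g⁻¹ = kerElt ((phi p g).val * A * (phi p g)⁻¹.val) := by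
  rw [mul_inv_eq_iff_eq_mul]
  apply mul_kerElt_of_eq
  rw [mul_assoc, ← Matrix.GeneralLinearGroup.coe_mul, inv_mul_cancel,
    Matrix.GeneralLinearGroup.coe_one, mul_one]

/-- Commuting elements with the same reduction have the same `p`-th power. -/
lemma pow_eq_of_commute {x y : GL2 (p^2)} (hc : Commute x y) (h : phi p x = phi p y) :
    x ^ p = y ^ p := by
  obtain ⟨A, hA⟩ := exists_eq_mul_kerElt h
  have hc' : Commute y (kerElt A) := by
    rw [eq_inv_mul_of_mul_eq hA.symm]
    exact (Commute.inv_right (Commute.refl y)).mul_right hc.symm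
  rw [hA, hc'.mul_pow, kerElt_pow, mul_one]

lemma trace_mul_kerElt (g : GL2 (p^2)) (A : Matrix (Fin 2) (Fin 2) (ZMod p)) :
    Matrix.trace (g * kerElt A : GL2 (p^2)).val =
      Matrix.trace g.val + mulP p (Matrix.trace ((phi p g).val * A)) := by
  rw [Matrix.GeneralLinearGroup.coe_mul, coe_kerElt, mul_add, mul_one, mul_map_mulP,
    Matrix.trace_add, AddMonoidHom.map_trace]
  rfl

lemma det_mul_kerElt (g : GL2 (p^2)) (A : Matrix (Fin 2) (Fin 2) (ZMod p)) :
    Matrix.det (g * kerElt A : GL2 (p^2)).val =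
      Matrix.det g.val * (1 + mulP p (Matrix.trace A)) := by
  rw [Matrix.GeneralLinearGroup.coe_mul, Matrix.det_mul, coe_kerElt]
  congr 1
  rw [Matrix.det_fin_two, Matrix.trace_fin_two]
  have h (x y : ZMod p) : mulP p x * mulP p y = 0 := by rw [mulP_mul, red_mulP, mul_zero, map_zero]
  simp
  linear_combination h (A 0 0) (A 1 1) - h (A 0 1) (A 1 0)

lemma trace_eq_of_isConj {n : ℕ} {x y : GL2 n} (h : IsConj x y) :
    Matrix.trace x.val = Matrix.trace y.val := by
  obtain ⟨c, rfl⟩ := isConj_iff.1 h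
  rw [Matrix.GeneralLinearGroup.coe_mul, Matrix.trace_mul_comm,
    ← Matrix.GeneralLinearGroup.coe_mul, inv_mul_cancel_left]

lemma det_eq_of_isConj {n : ℕ} {x y : GL2 n} (h : IsConj x y) :
    Matrix.det x.val = Matrix.det y.val := by
  obtain ⟨c, rfl⟩ := isConj_iff.1 h
  rw [Matrix.GeneralLinearGroup.coe_mul, Matrix.det_mul_comm,
    ← Matrix.GeneralLinearGroup.coe_mul, inv_mul_cancel_left]

lemma trace_eq_of_isConj_mul_kerElt [Fact p.Prime] {g : GL2 (p^2)}
    {A B : Matrix (Fin 2) (Fin 2) (ZMod p)} (h : IsConj (g * kerElt A) (g * kerElt B)) :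
    Matrix.trace A = Matrix.trace B ∧
      Matrix.trace ((phi p g).val * A) = Matrix.trace ((phi p g).val * B) := by
  have h1 := trace_eq_of_isConj h
  have h2 := det_eq_of_isConj h
  rw [trace_mul_kerElt, trace_mul_kerElt, add_right_inj] at h1
  rw [det_mul_kerElt, det_mul_kerElt,
    ((Matrix.isUnit_iff_isUnit_det _).1 g.isUnit).mul_right_inj, add_right_inj] at h2
  exact ⟨mulP_injective h2, mulP_injective h1⟩

lemma charpoly_data_eq_of_isConj_kerElt [Fact p.Prime]
    {A B : Matrix (Fin 2) (Fin 2) (ZMod p)} (h : IsConj (kerElt A) (kerElt B)) :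
    Matrix.trace A = Matrix.trace B ∧ Matrix.det A = Matrix.det B ∧ (A = 0 ↔ B = 0) := by
  obtain ⟨c, hc⟩ := isConj_iff.1 h
  have hA : A = 0 ↔ kerElt A = 1 := by rw [← kerElt_zero, kerElt_injective.eq_iff]
  have hB : B = 0 ↔ kerElt B = 1 := by rw [← kerElt_zero, kerElt_injective.eq_iff]
  refine ⟨(trace_eq_of_isConj_mul_kerElt (g := 1) (by simpa using h)).1, ?_, ?_⟩
  · rw [conj_kerElt] at hc
    rw [← kerElt_injective hc, Matrix.det_mul_comm, ← mul_assoc,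
      ← Matrix.GeneralLinearGroup.coe_mul, inv_mul_cancel, Matrix.GeneralLinearGroup.coe_one,
      one_mul]
  · rw [hA, hB, ← hc, conj_eq_one_iff]

end Reduction

section Cartan

/-- The matrix of multiplication by `w + y√ε` in the basis `1, √ε`. -/
def cartan {R : Type*} [CommRing R] (ε : R) : R × R →ₗ[R] Matrix (Fin 2) (Fin 2) R where
  toFun u := !![u.1, ε * u.2; u.2, u.1]
  map_add' u v := by ext i j; fin_cases i <;> fin_cases j <;> simp [mul_add]
  map_smul' c u := by ext i j; fin_cases i <;> fin_cases j <;> simp [mul_left_comm]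

/-- The matrix of multiplication by `w + y√ε` composed with the conjugation `√ε ↦ -√ε`. -/
def anticartan {R : Type*} [CommRing R] (ε : R) : R × R →ₗ[R] Matrix (Fin 2) (Fin 2) R where
  toFun u := !![u.1, -(ε * u.2); u.2, -u.1]
  map_add' u v := by ext i j; fin_cases i <;> fin_cases j <;> simp [mul_add, add_comm]
  map_smul' c u := by ext i j; fin_cases i <;> fin_cases j <;> simp [mul_left_comm]

lemma cartan_apply {R : Type*} [CommRing R] (ε : R) (u : R × R) :
    cartan ε u = !![u.1, ε * u.2; u.2, u.1] := rfl

lemma anticartan_apply {R : Type*} [CommRing R] (ε : R) (u : R × R) :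
    anticartan ε u = !![u.1, -(ε * u.2); u.2, -u.1] := rfl

lemma cartan_mul_comm {R : Type*} [CommRing R] (ε : R) (u v : R × R) :
    cartan ε u * cartan ε v = cartan ε v * cartan ε u := by
  rw [cartan_apply, cartan_apply, Matrix.mul_fin_two, Matrix.mul_fin_two]
  ext i j
  fin_cases i <;> fin_cases j <;> simp <;> ring

lemma trace_cartan {R : Type*} [CommRing R] (ε : R) (u : R × R) :
    (cartan ε u).trace = 2 * u.1 := by
  rw [cartan_apply, Matrix.trace_fin_two_of, two_mul]

lemma det_cartan {R : Type*} [CommRing R] (ε : R) (u : R × R) :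
    (cartan ε u).det = u.1 * u.1 - ε * u.2 * u.2 := by
  rw [cartan_apply, Matrix.det_fin_two_of]

variable {p : ℕ} [Fact p.Prime]

lemma two_ne_zero_of_odd (hp : Odd p) : (2 : ZMod p) ≠ 0 := by
  intro h
  have h2 : ((2 : ℕ) : ZMod p) = 0 := by exact_mod_cast h
  rw [ZMod.natCast_eq_zero_iff, Nat.prime_dvd_prime_iff_eq Fact.out Nat.prime_two] at h2
  subst h2
  exact absurd hp (by decide)

/-- Frobenius acts as conjugation on the nonsplit Cartan algebra. -/
lemma cartan_pow (hp : Odd p) {ε : ZMod p} (hε : ¬ IsSquare ε) (u : ZMod p × ZMod p) :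
    cartan ε u ^ p = cartan ε (u.1, -u.2) := by
  have hε0 : ε ≠ 0 := by rintro rfl; exact hε (IsSquare.zero)
  have he : ε ^ (p / 2) = -1 :=
    (ZMod.pow_div_two_eq_neg_one_or_one p hε0).resolve_left
      fun h => hε ((ZMod.euler_criterion p hε0).2 h)
  have hJ2 : cartan ε (0, 1) ^ 2 = ε • (1 : Matrix (Fin 2) (Fin 2) (ZMod p)) := by
    rw [pow_two, cartan_apply, Matrix.mul_fin_two, Matrix.one_fin_two]
    simp
  have hJ : cartan ε (0, 1) ^ p = -cartan ε (0, 1) := by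
    have h : cartan ε (0, 1) ^ p = cartan ε (0, 1) ^ (2 * (p / 2) + 1) :=
      congrArg (cartan ε (0, 1) ^ ·) (Nat.two_mul_div_two_add_one_of_odd hp).symm
    rw [h, pow_succ, pow_mul, hJ2, smul_pow, he, one_pow, smul_mul_assoc, one_mul,
      neg_one_smul]
  have hu : cartan ε u = u.1 • 1 + u.2 • cartan ε (0, 1) := by
    rw [cartan_apply, cartan_apply, Matrix.one_fin_two]
    simp [mul_comm]
  rw [hu, add_pow_char_of_commute p, smul_pow, smul_pow, one_pow, hJ, ZMod.pow_card, ZMod.pow_card,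
    cartan_apply, cartan_apply, Matrix.one_fin_two]
  · simp [mul_comm]
  · exact ((Commute.one_left _).smul_left _).smul_right _

lemma exists_cartan_add_anticartan (hp : Odd p) {ε : ZMod p} (hε : ε ≠ 0)
    (A : Matrix (Fin 2) (Fin 2) (ZMod p)) : ∃ u v, A = cartan ε u + anticartan ε v := by
  have h2 := two_ne_zero_of_odd hp
  refine ⟨((A 0 0 + A 1 1) / 2, (A 1 0 + A 0 1 / ε) / 2),
    ((A 0 0 - A 1 1) / 2, (A 1 0 - A 0 1 / ε) / 2), ?_⟩
  rw [cartan_apply, anticartan_apply]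
  ext i j
  fin_cases i <;> fin_cases j <;> simp <;> field_simp <;> ring

lemma eq_or_eq_neg_of_isConj (hp : Odd p) {ε : ZMod p} (hε : ε ≠ 0) {x y : GL2 p}
    {u v : ZMod p × ZMod p} (hx : x.val = cartan ε u) (hy : y.val = cartan ε v)
    (h : IsConj x y) : v = u ∨ v = (u.1, -u.2) := by
  have h1 := trace_eq_of_isConj h
  have h2 := det_eq_of_isConj h
  rw [hx, hy, trace_cartan, trace_cartan] at h1
  have h3 := mul_left_cancel₀ (two_ne_zero_of_odd hp) h1
  rw [hx, hy, det_cartan, det_cartan, ← h3] at h2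
  have h4 : v.2 * v.2 = u.2 * u.2 := mul_left_cancel₀ hε (by linear_combination h2)
  rcases mul_self_eq_mul_self_iff.1 h4 with h | h
  · exact Or.inl (Prod.ext h3.symm h)
  · exact Or.inr (Prod.ext h3.symm h)

lemma eq_or_eq_pow_of_isConj (hp : Odd p) {ε : ZMod p} (hε : ¬ IsSquare ε) {x y : GL2 p}
    {u v : ZMod p × ZMod p} (hx : x.val = cartan ε u) (hy : y.val = cartan ε v)
    (h : IsConj x y) : y = x ∨ y = x ^ p := by
  have hε0 : ε ≠ 0 := by rintro rfl; exact hε (IsSquare.zero)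
  rcases eq_or_eq_neg_of_isConj hp hε0 hx hy h with rfl | rfl
  · exact Or.inl (Units.ext (hy.trans hx.symm))
  · refine Or.inr (Units.ext ?_)
    rw [Units.val_pow_eq_pow_val, hx, cartan_pow hp hε, hy]

lemma pow_sq_eq_self (hp : Odd p) {ε : ZMod p} (hε : ¬ IsSquare ε) {x : GL2 p}
    {u : ZMod p × ZMod p} (hx : x.val = cartan ε u) : (x ^ p) ^ p = x := by
  refine Units.ext ?_
  rw [Units.val_pow_eq_pow_val, Units.val_pow_eq_pow_val, hx, cartan_pow hp hε, cartan_pow hp hε,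
    neg_neg]

/-- The involution `diag(1, -1)` of `GL₂(ℤ/p²ℤ)`. -/
def conjGL (p : ℕ) : GL2 (p^2) where
  val := !![1, 0; 0, -1]
  inv := !![1, 0; 0, -1]
  val_inv := by rw [Matrix.mul_fin_two, Matrix.one_fin_two]; simp
  inv_val := by rw [Matrix.mul_fin_two, Matrix.one_fin_two]; simp

lemma conjGL_mul_self (p : ℕ) : conjGL p * conjGL p = 1 :=
  Units.ext (conjGL p).val_inv

lemma conjGL_inv (p : ℕ) : (conjGL p)⁻¹ = conjGL p := rfl

lemma phi_conjGL (p : ℕ) : (phi p (conjGL p)).val = !![1, 0; 0, -1] := by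
  rw [coe_phi]
  ext i j
  fin_cases i <;> fin_cases j <;> simp [conjGL]

lemma exists_anticartan_conj (hp : Odd p) {ε : ZMod p} (hε : ε ≠ 0) {t : ZMod p × ZMod p}
    (ht : t.2 ≠ 0) (v : ZMod p × ZMod p) :
    ∃ x, cartan ε t * anticartan ε (x - v) = anticartan ε x * cartan ε t := by
  have h2 := two_ne_zero_of_odd hp
  refine ⟨((t.1 * v.2 + t.2 * v.1) / (2 * t.2),
    (t.1 * v.1 + ε * t.2 * v.2) / (2 * t.2 * ε)), ?_⟩
  rw [cartan_apply, anticartan_apply, anticartan_apply, Matrix.mul_fin_two, Matrix.mul_fin_two]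
  ext i j
  fin_cases i <;> fin_cases j <;> simp <;> field_simp <;> ring

/-- A nonscalar element of the nonsplit Cartan group modulo `p` has a multiplicative lift. -/
lemma exists_multiplicative_lift (hp : Odd p) {ε : ZMod p} (hε : ¬ IsSquare ε) {t : GL2 p}
    {w : ZMod p × ZMod p} (ht : t.val = cartan ε w) (hw : w.2 ≠ 0) :
    ∃ τ : GL2 (p^2), phi p τ = t ∧ (τ ^ p) ^ p = τ ∧ conjGL p * τ * (conjGL p)⁻¹ = τ ^ p ∧
      (∀ (b : GL2 p) (u : ZMod p × ZMod p), b.val = cartan ε u →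
        ∃ x, phi p x = b ∧ Commute x τ) ∧
      ∀ g, phi p g = t → ∃ A, ((kerElt A * g * (kerElt A)⁻¹) ^ p) ^ p = τ := by
  have hε0 : ε ≠ 0 := by rintro rfl; exact hε (IsSquare.zero)
  obtain ⟨e, he⟩ := red_surjective p ε
  have lift (b : GL2 p) (u : ZMod p × ZMod p) (hb : b.val = cartan ε u) :
      ∃ x : GL2 (p^2), phi p x = b ∧ ∃ U, x.val = cartan e U := by
    obtain ⟨U₁, h₁⟩ := red_surjective p u.1
    obtain ⟨U₂, h₂⟩ := red_surjective p u.2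
    obtain ⟨x, hx, hxb⟩ := exists_lift (cartan e (U₁, U₂)) b (by
      rw [hb, cartan_apply, cartan_apply]
      ext i j
      fin_cases i <;> fin_cases j <;> simp [h₁, h₂, he])
    exact ⟨x, hxb, _, hx⟩
  have comm {x y : GL2 (p^2)} {U V} (hx : x.val = cartan e U) (hy : y.val = cartan e V) :
      Commute x y := by
    refine Units.ext ?_
    rw [Units.val_mul, Units.val_mul, hx, hy, cartan_mul_comm]
  obtain ⟨s, hst, W, hs⟩ := lift t w ht
  have hconj : (conjGL p * s * (conjGL p)⁻¹).val = cartan e (W.1, -W.2) := by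
    rw [Units.val_mul, Units.val_mul, hs, conjGL_inv, conjGL, cartan_apply, cartan_apply,
      Matrix.mul_fin_two, Matrix.mul_fin_two]
    simp
  have hφ : phi p ((s ^ p) ^ p) = t := by
    rw [map_pow, map_pow, hst, pow_sq_eq_self hp hε ht]
  have hss : ((s ^ p) ^ p) ^ p = s ^ p :=
    pow_eq_of_commute (((Commute.refl s).pow_left p).pow_left p) (by rw [hφ, hst])
  refine ⟨(s ^ p) ^ p, hφ, by rw [hss], ?_, ?_, ?_⟩
  · rw [← conj_pow, ← conj_pow]
    congr 1
    refine pow_eq_of_commute ((comm hconj hs).pow_right p) ?_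
    refine Units.ext ?_
    rw [map_pow, hst, Units.val_pow_eq_pow_val, ht, cartan_pow hp hε]
    rw [map_mul, map_mul, hst, conjGL_inv, Units.val_mul, Units.val_mul, phi_conjGL, ht,
      cartan_apply, cartan_apply, Matrix.mul_fin_two, Matrix.mul_fin_two]
    simp
  · intro b u hb
    obtain ⟨x, hx, U, hU⟩ := lift b u hb
    exact ⟨x, hx, ((comm hU hs).pow_right p).pow_right p⟩
  · intro g hg
    obtain ⟨A, rfl⟩ := exists_eq_mul_kerElt (hg.trans hst.symm)
    obtain ⟨u, v, rfl⟩ := exists_cartan_add_anticartan hp hε0 A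
    obtain ⟨x, hx⟩ := exists_anticartan_conj hp hε0 hw v
    refine ⟨anticartan ε x, ?_⟩
    have h1 : s * kerElt (anticartan ε (x - v)) = kerElt (anticartan ε x) * s :=
      mul_kerElt_of_eq s (by rw [hst, ht, hx])
    have h2 : kerElt (anticartan ε x) * (s * kerElt (cartan ε u + anticartan ε v)) *
        (kerElt (anticartan ε x))⁻¹ = s * kerElt (cartan ε u) := by
      rw [← mul_assoc, ← h1, ← kerElt_neg, mul_assoc, mul_assoc, ← kerElt_add, ← kerElt_add,
        map_sub]
      congr 2
      abel
    have h3 : Commute s (kerElt (cartan ε u)) :=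
      mul_kerElt_of_eq s (by rw [hst, ht, cartan_mul_comm])
    rw [h2, h3.mul_pow, kerElt_pow, mul_one]

end Cartan

section Decomposition

variable {p : ℕ} [Fact p.Prime]

/-- The norm of `w + y√ε`. -/
def cartanNorm (ε : ZMod p) (u : ZMod p × ZMod p) : ZMod p := u.1 * u.1 - ε * u.2 * u.2

lemma cartanNorm_ne_zero {ε : ZMod p} (hε : ¬ IsSquare ε) {u : ZMod p × ZMod p} (hu : u ≠ 0) :
    cartanNorm ε u ≠ 0 := by
  intro h
  rw [cartanNorm, sub_eq_zero] at h
  by_cases h2 : u.2 = 0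
  · rw [h2, mul_zero, mul_self_eq_zero] at h
    exact hu (Prod.ext h h2)
  · exact hε ⟨u.1 / u.2, by field_simp; linear_combination -h⟩

lemma trace_cartan_add_anticartan (ε : ZMod p) (u v : ZMod p × ZMod p) :
    (cartan ε u + anticartan ε v).trace = 2 * u.1 := by
  rw [Matrix.trace_add, trace_cartan, anticartan_apply, Matrix.trace_fin_two_of, add_neg_cancel,
    add_zero]

lemma trace_cartan_mul (ε : ZMod p) (w u v : ZMod p × ZMod p) :
    (cartan ε w * (cartan ε u + anticartan ε v)).trace = 2 * (w.1 * u.1 + ε * w.2 * u.2) := by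
  rw [mul_add, cartan_apply, cartan_apply, anticartan_apply, Matrix.mul_fin_two, Matrix.mul_fin_two,
    Matrix.trace_add, Matrix.trace_fin_two_of, Matrix.trace_fin_two_of]
  ring

lemma det_cartan_add_anticartan (ε : ZMod p) (u v : ZMod p × ZMod p) :
    (cartan ε u + anticartan ε v).det = cartanNorm ε u - cartanNorm ε v := by
  rw [cartan_apply, anticartan_apply, Matrix.det_fin_two, cartanNorm, cartanNorm]
  simp
  ring

lemma eq_of_trace_eq (hp : Odd p) {ε : ZMod p} (hε : ε ≠ 0) {w u v u' v' : ZMod p × ZMod p}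
    (hw : w.2 ≠ 0)
    (h1 : (cartan ε u + anticartan ε v).trace = (cartan ε u' + anticartan ε v').trace)
    (h2 : (cartan ε w * (cartan ε u + anticartan ε v)).trace =
      (cartan ε w * (cartan ε u' + anticartan ε v')).trace) : u = u' := by
  have h := two_ne_zero_of_odd hp
  rw [trace_cartan_add_anticartan, trace_cartan_add_anticartan] at h1
  rw [trace_cartan_mul, trace_cartan_mul] at h2
  have h3 := mul_left_cancel₀ h h1
  have h4 := mul_left_cancel₀ h h2
  rw [h3, add_right_inj] at h4
  exact Prod.ext h3 (mul_left_cancel₀ (mul_ne_zero hε hw) h4)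

lemma cartan_add_anticartan_eq_zero (hp : Odd p) {ε : ZMod p} (hε : ε ≠ 0)
    {u v : ZMod p × ZMod p} (h : cartan ε u + anticartan ε v = 0) : u = 0 ∧ v = 0 := by
  have hu : u = 0 := eq_of_trace_eq hp hε (w := (0, 1)) (v := v) (v' := 0) one_ne_zero
    (by simp [h]) (by simp [h])
  subst hu
  rw [map_zero, zero_add] at h
  exact ⟨rfl, Prod.ext (congrFun (congrFun h 0) 0) (congrFun (congrFun h 1) 0)⟩

/-- The subspace of matrices `A` modulo `p` such that `1 + pA` lies in `H`. -/
def kerSub (H : Subgroup (GL2 (p^2))) : Submodule (ZMod p) (Matrix (Fin 2) (Fin 2) (ZMod p)) :=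
  AddSubgroup.toZModSubmodule p
    { carrier := {A | kerElt A ∈ H}
      zero_mem' := by simp [H.one_mem]
      add_mem' := fun {A B} hA hB => by
        rw [Set.mem_ofPred_eq, kerElt_add]
        exact H.mul_mem hA hB
      neg_mem' := fun {A} hA => by
        rw [Set.mem_ofPred_eq, kerElt_neg]
        exact H.inv_mem hA }

lemma mem_kerSub {H : Subgroup (GL2 (p^2))} {A : Matrix (Fin 2) (Fin 2) (ZMod p)} :
    A ∈ kerSub H ↔ kerElt A ∈ H := Iff.rfl

/-- The kernel of reduction on `H` splits along the decomposition of `M₂(ℤ/pℤ)` into the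
nonsplit Cartan algebra and its complement. -/
lemma cartan_add_anticartan_mem (hp : Odd p) {ε : ZMod p} (hε : ¬ IsSquare ε)
    {H : Subgroup (GL2 (p^2))} {τ : GL2 (p^2)} (hτ : τ ∈ H) {w : ZMod p × ZMod p}
    (hw : (phi p τ).val = cartan ε w) (hw2 : w.2 ≠ 0) (u v : ZMod p × ZMod p) :
    cartan ε u + anticartan ε v ∈ kerSub H ↔
      cartan ε u ∈ kerSub H ∧ anticartan ε v ∈ kerSub H := by
  refine ⟨fun h => ?_, fun h => add_mem h.1 h.2⟩
  have hε0 : ε ≠ 0 := by rintro rfl; exact hε (IsSquare.zero)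
  have hw0 : w ≠ 0 := by rintro rfl; exact hw2 rfl
  have hN := cartanNorm_ne_zero hε hw0
  have hTT : cartan ε w * cartan ε (w.1, -w.2) = cartanNorm ε w • 1 := by
    rw [cartan_apply, cartan_apply, Matrix.mul_fin_two, Matrix.one_fin_two, cartanNorm]
    ext i j
    fin_cases i <;> fin_cases j <;> simp <;> ring
  have hstab {A} (hA : A ∈ kerSub H) : cartan ε w * A * cartan ε (w.1, -w.2) ∈ kerSub H := by
    have h1 : cartan ε w * A * (phi p τ)⁻¹.val ∈ kerSub H := by
      rw [mem_kerSub, ← hw, ← conj_kerElt]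
      exact H.mul_mem (H.mul_mem hτ hA) (H.inv_mem hτ)
    have h2 : cartan ε (w.1, -w.2) = cartanNorm ε w • (phi p τ)⁻¹.val := by
      rw [← mul_one (phi p τ)⁻¹.val, ← mul_smul_comm, ← hTT, ← mul_assoc, ← hw, Units.inv_mul,
        one_mul]
    rw [h2, mul_smul_comm]
    exact Submodule.smul_mem _ _ h1
  have key : (-(4 * ε * w.2 ^ 2 * cartanNorm ε w)) • cartan ε u ∈ kerSub H := by
    have h3 := add_mem (sub_mem (hstab (hstab h))
      (Submodule.smul_mem _ (2 * (w.1 ^ 2 + ε * w.2 ^ 2)) (hstab h)))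
      (Submodule.smul_mem _ (cartanNorm ε w ^ 2) h)
    convert h3 using 1
    simp only [cartan_apply, anticartan_apply, cartanNorm]
    ext i j
    fin_cases i <;> fin_cases j <;> simp <;> ring
  have hc : -(4 * ε * w.2 ^ 2 * cartanNorm ε w) ≠ 0 := by
    have h4 : (4 : ZMod p) ≠ 0 := by
      have h2 := mul_ne_zero (two_ne_zero_of_odd hp) (two_ne_zero_of_odd hp)
      norm_num at h2
      exact h2
    exact neg_ne_zero.2 (mul_ne_zero (mul_ne_zero (mul_ne_zero h4 hε0) (pow_ne_zero 2 hw2)) hN)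
  have hu := (Submodule.smul_mem_iff _ hc).1 key
  exact ⟨hu, by simpa using sub_mem h hu⟩

lemma card_kerSub (hp : Odd p) {ε : ZMod p} (hε : ¬ IsSquare ε)
    {H : Subgroup (GL2 (p^2))} {τ : GL2 (p^2)} (hτ : τ ∈ H) {w : ZMod p × ZMod p}
    (hw : (phi p τ).val = cartan ε w) (hw2 : w.2 ≠ 0) :
    Nat.card (kerSub H) = Nat.card ((kerSub H).comap (cartan ε)) *
      Nat.card ((kerSub H).comap (anticartan ε)) := by
  have hε0 : ε ≠ 0 := by rintro rfl; exact hε (IsSquare.zero)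
  rw [← Nat.card_prod]
  refine (Nat.card_congr (Equiv.ofBijective
    (fun x => ⟨cartan ε x.1.1 + anticartan ε x.2.1, add_mem x.1.2 x.2.2⟩) ⟨?_, ?_⟩)).symm
  · rintro ⟨⟨u, hu⟩, ⟨v, hv⟩⟩ ⟨⟨u', hu'⟩, ⟨v', hv'⟩⟩ h
    have h1 : cartan ε u + anticartan ε v = cartan ε u' + anticartan ε v' := congrArg Subtype.val h
    obtain ⟨h2, h3⟩ := cartan_add_anticartan_eq_zero hp hε0 (u := u - u') (v := v - v') (by
      rw [map_sub, map_sub, sub_add_sub_comm, h1, sub_self])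
    obtain rfl := sub_eq_zero.1 h2
    obtain rfl := sub_eq_zero.1 h3
    rfl
  · rintro ⟨A, hA⟩
    obtain ⟨u, v, rfl⟩ := exists_cartan_add_anticartan hp hε0 A
    obtain ⟨hu, hv⟩ := (cartan_add_anticartan_mem hp hε hτ hw hw2 u v).1 hA
    exact ⟨⟨⟨u, hu⟩, ⟨v, hv⟩⟩, rfl⟩

/-- Conjugation by the nonsplit Cartan group carries one line of the complement to another as soon
as their norms agree up to squares. -/
lemma exists_cartan_conj_line (hp : Odd p) {ε : ZMod p} (hε : ¬ IsSquare ε)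
    {a b : ZMod p × ZMod p} (ha : a ≠ 0) (hb : b ≠ 0)
    (h : IsSquare (cartanNorm ε a * cartanNorm ε b)) :
    ∃ u ≠ 0, ∃ c : ZMod p,
      cartan ε u * anticartan ε a = anticartan ε (c • b) * cartan ε u := by
  obtain ⟨r, hr⟩ := h
  set g := b.1 * a.1 - ε * b.2 * a.2 with hg
  wlog hr2 : r + g ≠ 0 generalizing r
  · refine this (-r) (by rw [hr]; ring) fun h => ?_
    push Not at hr2
    have h0 : 2 * r = 0 := by linear_combination hr2 - h
    have hr0 := (mul_eq_zero.1 h0).resolve_left (two_ne_zero_of_odd hp)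
    rw [hr0, mul_zero] at hr
    exact mul_ne_zero (cartanNorm_ne_zero hε ha) (cartanNorm_ne_zero hε hb) hr
  have hr0 : r ≠ 0 := by
    rintro rfl
    rw [mul_zero] at hr
    exact mul_ne_zero (cartanNorm_ne_zero hε ha) (cartanNorm_ne_zero hε hb) hr
  refine ⟨(r + g, b.2 * a.1 - b.1 * a.2), fun h => hr2 (congrArg Prod.fst h),
    cartanNorm ε a / r, ?_⟩
  rw [cartanNorm, cartanNorm] at hr
  rw [cartan_apply, anticartan_apply, anticartan_apply, Matrix.mul_fin_two, Matrix.mul_fin_two,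
    cartanNorm, hg]
  ext i j
  fin_cases i <;> fin_cases j <;> simp <;> field_simp
  · linear_combination -a.1 * hr
  · linear_combination ε * a.2 * hr
  · linear_combination -a.2 * hr
  · linear_combination a.1 * hr

lemma exists_cartan_conj (hp : Odd p) {ε : ZMod p} (hε : ¬ IsSquare ε)
    (W₁ W₂ : Submodule (ZMod p) (ZMod p × ZMod p)) (hcard : Nat.card W₁ = Nat.card W₂)
    (hsq : ∀ a ∈ W₁, ∀ b ∈ W₂, a ≠ 0 → b ≠ 0 → (∀ b' ∈ W₂, ∃ c : ZMod p, b' = c • b) →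
      (∀ a' ∈ W₁, ∃ c : ZMod p, a' = c • a) → IsSquare (cartanNorm ε a * cartanNorm ε b)) :
    ∃ u ≠ 0, ∀ v ∈ W₁, ∃ v' ∈ W₂, cartan ε u * anticartan ε v = anticartan ε v' * cartan ε u := by
  have hone : cartan ε (1, 0) = 1 := by rw [cartan_apply, Matrix.one_fin_two]; simp
  have hfin : Module.finrank (ZMod p) W₁ = Module.finrank (ZMod p) W₂ := by
    rw [Module.natCard_eq_pow_finrank (K := ZMod p) (V := W₁),
      Module.natCard_eq_pow_finrank (K := ZMod p) (V := W₂), Nat.card_zmod] at hcard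
    exact Nat.pow_right_injective (Fact.out : p.Prime).two_le hcard
  have hle : Module.finrank (ZMod p) W₁ ≤ 2 := by
    simpa using Submodule.finrank_le W₁
  have hcases : Module.finrank (ZMod p) W₁ = 0 ∨ Module.finrank (ZMod p) W₁ = 1 ∨
      Module.finrank (ZMod p) W₁ = 2 := by omega
  rcases hcases with h | h | h
  · rw [Submodule.finrank_eq_zero] at h
    subst h
    refine ⟨(1, 0), by simp, fun v hv => ⟨0, zero_mem _, ?_⟩⟩
    rw [(Submodule.mem_bot _).1 hv, map_zero, mul_zero, zero_mul]
  · have h' := hfin ▸ h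
    obtain ⟨⟨a, ha⟩, ha0, haW⟩ := finrank_eq_one_iff'.1 h
    obtain ⟨⟨b, hb⟩, hb0, hbW⟩ := finrank_eq_one_iff'.1 h'
    have ha0' : a ≠ 0 := fun h => ha0 (Subtype.ext h)
    have hb0' : b ≠ 0 := fun h => hb0 (Subtype.ext h)
    have haW' : ∀ a' ∈ W₁, ∃ c : ZMod p, a' = c • a := fun a' h => by
      obtain ⟨c, hc⟩ := haW ⟨a', h⟩
      exact ⟨c, congrArg Subtype.val hc.symm⟩
    have hbW' : ∀ b' ∈ W₂, ∃ c : ZMod p, b' = c • b := fun b' h => by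
      obtain ⟨c, hc⟩ := hbW ⟨b', h⟩
      exact ⟨c, congrArg Subtype.val hc.symm⟩
    obtain ⟨u, hu, c, hc⟩ := exists_cartan_conj_line hp hε ha0' hb0'
      (hsq a ha b hb ha0' hb0' hbW' haW')
    refine ⟨u, hu, fun v hv => ?_⟩
    obtain ⟨d, rfl⟩ := haW' v hv
    refine ⟨d • c • b, Submodule.smul_mem _ _ (Submodule.smul_mem _ _ hb), ?_⟩
    rw [map_smul, mul_smul_comm, hc, map_smul _ d, smul_mul_assoc]
  · have htop : W₂ = ⊤ := Submodule.eq_top_of_finrank_eq (by rw [← hfin, h]; simp)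
    refine ⟨(1, 0), by simp, fun v _ => ⟨v, htop ▸ Submodule.mem_top, ?_⟩⟩
    rw [hone, one_mul, mul_one]

lemma isSquare_of_nilpotent_transfer (hp : Odd p) {ε : ZMod p} (hε : ¬ IsSquare ε)
    (V₁ V₂ : Submodule (ZMod p) (Matrix (Fin 2) (Fin 2) (ZMod p)))
    (hV₂ : ∀ u v, cartan ε u + anticartan ε v ∈ V₂ → anticartan ε v ∈ V₂)
    (htransfer : ∀ A ∈ V₁, ∃ B ∈ V₂, A.trace = B.trace ∧ A.det = B.det ∧ (A = 0 ↔ B = 0))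
    {a b : ZMod p × ZMod p} (ha : anticartan ε a ∈ V₁) (ha0 : a ≠ 0)
    (hb : ∀ v, anticartan ε v ∈ V₂ → ∃ c : ZMod p, v = c • b)
    (hJ : cartan ε (0, 1) ∈ V₁) (h : IsSquare (-ε * cartanNorm ε a)) :
    IsSquare (-ε * cartanNorm ε b) := by
  have hε0 : ε ≠ 0 := by rintro rfl; exact hε (IsSquare.zero)
  obtain ⟨s, hs⟩ := h
  have hmem : cartan ε (0, s / ε) + anticartan ε a ∈ V₁ := by
    have : ((0 : ZMod p), s / ε) = (s / ε) • ((0 : ZMod p), (1 : ZMod p)) := by simp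
    rw [this, map_smul]
    exact add_mem (Submodule.smul_mem _ _ hJ) ha
  obtain ⟨B, hB, htr, hdet, hzero⟩ := htransfer _ hmem
  obtain ⟨u, v, rfl⟩ := exists_cartan_add_anticartan hp hε0 B
  obtain ⟨c, rfl⟩ := hb v (hV₂ u v hB)
  rw [trace_cartan_add_anticartan, trace_cartan_add_anticartan] at htr
  have hu1 : u.1 = 0 := (mul_left_cancel₀ (two_ne_zero_of_odd hp) htr).symm
  have hdet0 : cartanNorm ε (0, s / ε) - cartanNorm ε a = 0 := by
    have h1 : ε * (cartanNorm ε (0, s / ε) - cartanNorm ε a) = 0 := by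
      simp only [cartanNorm] at hs ⊢
      field_simp
      linear_combination hs
    exact (mul_eq_zero.1 h1).resolve_left hε0
  rw [det_cartan_add_anticartan, det_cartan_add_anticartan, hdet0] at hdet
  have h2 : c * c * cartanNorm ε b = -ε * u.2 * u.2 := by
    simp only [cartanNorm, hu1, Prod.smul_fst, Prod.smul_snd, smul_eq_mul] at hdet ⊢
    linear_combination hdet
  have hc : c ≠ 0 := by
    rintro rfl
    have hu2 : u.2 = 0 := by
      have h3 : ε * (u.2 * u.2) = 0 := by linear_combination h2
      exact mul_self_eq_zero.1 ((mul_eq_zero.1 h3).resolve_left hε0)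
    have hu : u = 0 := Prod.ext hu1 hu2
    have h4 := hzero.2 (by rw [hu, zero_smul, map_zero, map_zero, add_zero])
    exact ha0 (cartan_add_anticartan_eq_zero hp hε0 h4).2
  refine ⟨ε * u.2 / c, ?_⟩
  field_simp
  linear_combination -h2

lemma isSquare_mul_of_iff (hp : Odd p) {x y : ZMod p} (h : IsSquare x ↔ IsSquare y) :
    IsSquare (x * y) := by
  by_cases hx : IsSquare x
  · exact hx.mul (h.1 hx)
  · have hchar : ringChar (ZMod p) ≠ 2 := by
      rw [ZMod.ringChar_zmod_n]
      rintro rfl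
      exact absurd hp (by decide)
    have hx' := quadraticChar_neg_one_iff_not_isSquare.2 hx
    have hy' := quadraticChar_neg_one_iff_not_isSquare.2 (fun hy => hx (h.2 hy))
    by_contra hxy
    have := quadraticChar_neg_one_iff_not_isSquare.2 hxy
    rw [map_mul, hx', hy'] at this
    norm_num at this

lemma isSquare_norm_mul_norm (hp : Odd p) {ε : ZMod p} (hε : ¬ IsSquare ε)
    (V₁ V₂ : Submodule (ZMod p) (Matrix (Fin 2) (Fin 2) (ZMod p)))
    (hV₁ : ∀ u v, cartan ε u + anticartan ε v ∈ V₁ → anticartan ε v ∈ V₁)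
    (hV₂ : ∀ u v, cartan ε u + anticartan ε v ∈ V₂ → anticartan ε v ∈ V₂)
    (hV : ∀ u, cartan ε u ∈ V₁ ↔ cartan ε u ∈ V₂)
    (h₁₂ : ∀ A ∈ V₁, ∃ B ∈ V₂, A.trace = B.trace ∧ A.det = B.det ∧ (A = 0 ↔ B = 0))
    (h₂₁ : ∀ A ∈ V₂, ∃ B ∈ V₁, A.trace = B.trace ∧ A.det = B.det ∧ (A = 0 ↔ B = 0))
    {a b : ZMod p × ZMod p} (ha : anticartan ε a ∈ V₁) (hb : anticartan ε b ∈ V₂)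
    (ha0 : a ≠ 0) (hb0 : b ≠ 0)
    (hb' : ∀ v, anticartan ε v ∈ V₂ → ∃ c : ZMod p, v = c • b)
    (ha' : ∀ v, anticartan ε v ∈ V₁ → ∃ c : ZMod p, v = c • a) :
    IsSquare (cartanNorm ε a * cartanNorm ε b) := by
  have hε0 : ε ≠ 0 := by rintro rfl; exact hε (IsSquare.zero)
  by_cases hJ : cartan ε (0, 1) ∈ V₁
  · obtain ⟨r, hr⟩ := isSquare_mul_of_iff hp
      ⟨isSquare_of_nilpotent_transfer hp hε V₁ V₂ hV₂ h₁₂ ha ha0 hb' hJ,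
        isSquare_of_nilpotent_transfer hp hε V₂ V₁ hV₁ h₂₁ hb hb0 ha' ((hV _).1 hJ)⟩
    refine ⟨r / ε, ?_⟩
    field_simp
    linear_combination hr
  · obtain ⟨B, hB, htr, hdet, -⟩ := h₁₂ _ ha
    obtain ⟨u, v, rfl⟩ := exists_cartan_add_anticartan hp hε0 B
    have hv := hV₂ u v hB
    obtain ⟨c, rfl⟩ := hb' v hv
    rw [← zero_add (anticartan ε a), ← map_zero (cartan ε), trace_cartan_add_anticartan,
      trace_cartan_add_anticartan] at htr
    have hu1 : u.1 = 0 := (mul_left_cancel₀ (two_ne_zero_of_odd hp) htr).symm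
    have hu : cartan ε u ∈ V₁ := (hV u).2 (by simpa using sub_mem hB hv)
    have hu2 : u.2 = 0 := by
      by_contra h0
      apply hJ
      have h1 : u = u.2 • ((0 : ZMod p), (1 : ZMod p)) := Prod.ext (by simp [hu1]) (by simp)
      rw [h1, map_smul] at hu
      exact (Submodule.smul_mem_iff _ h0).1 hu
    rw [← zero_add (anticartan ε a), ← map_zero (cartan ε), det_cartan_add_anticartan,
      det_cartan_add_anticartan] at hdet
    refine ⟨c * cartanNorm ε b, ?_⟩
    simp only [cartanNorm, hu1, hu2, Prod.smul_fst, Prod.smul_snd, smul_eq_mul, Prod.fst_zero,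
      Prod.snd_zero] at hdet ⊢
    linear_combination (-(b.1 * b.1 - ε * b.2 * b.2)) * hdet

end Decomposition

section LocalConjugacy

variable {G : Type*} [Group G]

lemma mem_map_conj {H : Subgroup G} {g x : G} :
    x ∈ H.map (MulAut.conj g).toMonoidHom ↔ g⁻¹ * x * g ∈ H := by
  constructor
  · rintro ⟨y, hy, rfl⟩
    simpa [mul_assoc] using hy
  · exact fun h => ⟨_, h, by simp [mul_assoc]⟩

lemma isLocallyConjugate_map_conj (H : Subgroup G) (g : G) :
    IsLocallyConjugate H (H.map (MulAut.conj g).toMonoidHom) :=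
  ⟨(H.equivMapOfInjective _ (MulAut.conj g).injective).toEquiv,
    fun _ => isConj_iff.2 ⟨g, rfl⟩⟩

lemma IsLocallyConjugate.symm {H₁ H₂ : Subgroup G} (h : IsLocallyConjugate H₁ H₂) :
    IsLocallyConjugate H₂ H₁ := by
  obtain ⟨f, hf⟩ := h
  exact ⟨f.symm, fun x => by simpa using (hf (f.symm x)).symm⟩

lemma IsLocallyConjugate.trans {H₁ H₂ H₃ : Subgroup G} (h : IsLocallyConjugate H₁ H₂)
    (h' : IsLocallyConjugate H₂ H₃) : IsLocallyConjugate H₁ H₃ := by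
  obtain ⟨f, hf⟩ := h
  obtain ⟨f', hf'⟩ := h'
  exact ⟨f.trans f', fun x => (hf x).trans (hf' (f x))⟩

lemma IsLocallyConjugate.exists_isConj {H₁ H₂ : Subgroup G} (h : IsLocallyConjugate H₁ H₂)
    {x : G} (hx : x ∈ H₁) : ∃ y ∈ H₂, IsConj x y := by
  obtain ⟨f, hf⟩ := h
  exact ⟨f ⟨x, hx⟩, (f ⟨x, hx⟩).2, hf ⟨x, hx⟩⟩

lemma IsLocallyConjugate.card_eq {H₁ H₂ : Subgroup G} (h : IsLocallyConjugate H₁ H₂) :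
    Nat.card H₁ = Nat.card H₂ := by
  obtain ⟨f, -⟩ := h
  exact Nat.card_congr f

lemma isConjugateSubgroup_map_conj (H : Subgroup G) (g : G) :
    IsConjugateSubgroup H (H.map (MulAut.conj g).toMonoidHom) := ⟨g, rfl⟩

lemma IsConjugateSubgroup.symm {H₁ H₂ : Subgroup G} (h : IsConjugateSubgroup H₁ H₂) :
    IsConjugateSubgroup H₂ H₁ := by
  obtain ⟨g, rfl⟩ := h
  refine ⟨g⁻¹, Subgroup.ext fun x => ?_⟩
  rw [mem_map_conj, mem_map_conj]
  simp [mul_assoc]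

lemma IsConjugateSubgroup.trans {H₁ H₂ H₃ : Subgroup G} (h : IsConjugateSubgroup H₁ H₂)
    (h' : IsConjugateSubgroup H₂ H₃) : IsConjugateSubgroup H₁ H₃ := by
  obtain ⟨g, rfl⟩ := h
  obtain ⟨g', rfl⟩ := h'
  refine ⟨g' * g, Subgroup.ext fun x => ?_⟩
  rw [mem_map_conj, mem_map_conj, mem_map_conj]
  simp [mul_assoc]

lemma Submodule.le_or_le_of_forall_mem_or {R M : Type*} [Ring R] [AddCommGroup M] [Module R M]
    {W V V' : Submodule R M} (h : ∀ u ∈ W, u ∈ V ∨ u ∈ V') : W ≤ V ∨ W ≤ V' := by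
  by_contra! hc
  obtain ⟨⟨a, ha, haV⟩, b, hb, hbV⟩ :=
    (⟨SetLike.not_le_iff_exists.1 hc.1, SetLike.not_le_iff_exists.1 hc.2⟩ :
      (∃ a ∈ W, a ∉ V) ∧ ∃ b ∈ W, b ∉ V')
  have ha' := (h a ha).resolve_left haV
  have hb' := (h b hb).resolve_right hbV
  rcases h (a + b) (add_mem ha hb) with h1 | h1
  · exact haV (by simpa using sub_mem h1 hb')
  · exact hbV (by simpa using sub_mem h1 ha')

end LocalConjugacy

section Conjugacy

lemma mem_map_conjGL {p : ℕ} {H : Subgroup (GL2 (p^2))} {x : GL2 (p^2)} :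
    x ∈ H.map (MulAut.conj (conjGL p)).toMonoidHom ↔ conjGL p * x * (conjGL p)⁻¹ ∈ H :=
  mem_map_conj

variable {p : ℕ} [Fact p.Prime]

/-- A group of matrices contained in the nonsplit Cartan algebra is cyclic. -/
lemma exists_generator_of_cartan {ε : ZMod p} (hε : ¬ IsSquare ε) (K : Subgroup (GL2 p))
    (hK : ∀ x ∈ K, ∃ u, x.val = cartan ε u) : ∃ t ∈ K, ∀ x ∈ K, x ∈ Subgroup.zpowers t := by
  have : Fact (∀ r : ZMod p, r ^ 2 ≠ ε + 0 * r) :=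
    ⟨fun r hr => hε ⟨r, by linear_combination -hr⟩⟩
  let f : K →* QuadraticAlgebra (ZMod p) ε 0 :=
    { toFun := fun x => ⟨x.1.val 0 0, x.1.val 1 0⟩
      map_one' := by ext <;> simp [QuadraticAlgebra.re_one, QuadraticAlgebra.im_one]
      map_mul' := fun x y => by
        obtain ⟨u, hu⟩ := hK x x.2
        obtain ⟨v, hv⟩ := hK y y.2
        ext <;> simp [Matrix.mul_apply, hu, hv, cartan_apply]
        ring }
  have hf : Function.Injective f := by
    intro x y h
    obtain ⟨u, hu⟩ := hK x x.2
    obtain ⟨v, hv⟩ := hK y y.2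
    have h1 : x.1.val 0 0 = y.1.val 0 0 := congrArg QuadraticAlgebra.re h
    have h2 : x.1.val 1 0 = y.1.val 1 0 := congrArg QuadraticAlgebra.im h
    rw [hu, hv] at h1 h2
    have huv : u = v := Prod.ext h1 h2
    exact Subtype.ext (Units.ext (by rw [hu, hv, huv]))
  obtain ⟨t, ht⟩ := (isCyclic_of_injective_ringHom f hf).exists_generator
  refine ⟨t, t.2, fun x hx => ?_⟩
  obtain ⟨k, hk⟩ := Subgroup.mem_zpowers_iff.1 (ht ⟨x, hx⟩)
  exact Subgroup.mem_zpowers_iff.2 ⟨k, congrArg Subtype.val hk⟩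

lemma map_phi_le (hp : Odd p) {ε : ZMod p} (hε : ¬ IsSquare ε) {H₁ H₂ : Subgroup (GL2 (p^2))}
    (h₁ : ∀ g ∈ H₁, ∃ u, (phi p g).val = cartan ε u)
    (h₂ : ∀ g ∈ H₂, ∃ u, (phi p g).val = cartan ε u) (h : IsLocallyConjugate H₁ H₂) :
    H₁.map (phi p) ≤ H₂.map (phi p) := by
  rintro _ ⟨x, hx, rfl⟩
  obtain ⟨y, hy, hxy⟩ := h.exists_isConj hx
  obtain ⟨u, hu⟩ := h₁ x hx
  obtain ⟨v, hv⟩ := h₂ y hy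
  rcases eq_or_eq_pow_of_isConj hp hε hv hu ((phi p).map_isConj hxy.symm) with h | h
  · exact ⟨y, hy, h.symm⟩
  · exact ⟨y ^ p, pow_mem hy p, by rw [map_pow, h]⟩

lemma exists_mem_kerSub_of_isLocallyConjugate {H₁ H₂ : Subgroup (GL2 (p^2))}
    (h : IsLocallyConjugate H₁ H₂) {A : Matrix (Fin 2) (Fin 2) (ZMod p)} (hA : A ∈ kerSub H₁) :
    ∃ B ∈ kerSub H₂, A.trace = B.trace ∧ A.det = B.det ∧ (A = 0 ↔ B = 0) := by
  obtain ⟨y, hy, hAy⟩ := h.exists_isConj hA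
  have h1 := (phi p).map_isConj hAy
  rw [phi_kerElt, isConj_one_right] at h1
  obtain ⟨B, rfl⟩ := exists_eq_kerElt h1
  exact ⟨B, hy, charpoly_data_eq_of_isConj_kerElt hAy⟩

lemma card_kerSub_le {H₁ H₂ : Subgroup (GL2 (p^2))} (h : IsLocallyConjugate H₁ H₂) :
    Nat.card (kerSub H₁) ≤ Nat.card (kerSub H₂) := by
  obtain ⟨f, hf⟩ := h
  have key (A : kerSub H₁) : ∃ B, (f ⟨kerElt A.1, A.2⟩ : GL2 (p^2)) = kerElt B := by
    apply exists_eq_kerElt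
    have h1 := (phi p).map_isConj (hf ⟨kerElt A.1, A.2⟩)
    rwa [phi_kerElt, isConj_one_right] at h1
  choose B hB using key
  have hmem (A) : B A ∈ kerSub H₂ := by
    rw [mem_kerSub, ← hB]
    exact (f _).2
  refine Nat.card_le_card_of_injective (fun A => (⟨B A, hmem A⟩ : kerSub H₂)) fun A A' hAA' => ?_
  have h1 : B A = B A' := congrArg Subtype.val hAA'
  have h2 := f.injective (Subtype.ext ((hB A).trans (h1 ▸ (hB A').symm)))
  exact Subtype.ext (kerElt_injective (congrArg Subtype.val h2))

lemma card_kerSub_eq {H₁ H₂ : Subgroup (GL2 (p^2))} (h : IsLocallyConjugate H₁ H₂) :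
    Nat.card (kerSub H₁) = Nat.card (kerSub H₂) :=
  le_antisymm (card_kerSub_le h) (card_kerSub_le h.symm)

/-- The conjugation `w + y√ε ↦ w - y√ε`. -/
def cartanConj (p : ℕ) : (ZMod p × ZMod p) ≃ₗ[ZMod p] (ZMod p × ZMod p) :=
  (LinearEquiv.refl _ _).prodCongr (LinearEquiv.neg _)

lemma cartanConj_apply (u : ZMod p × ZMod p) : cartanConj p u = (u.1, -u.2) := rfl

lemma phi_conjGL_mul_cartan (ε : ZMod p) (u : ZMod p × ZMod p) :
    (phi p (conjGL p)).val * cartan ε u = cartan ε (cartanConj p u) * (phi p (conjGL p)).val := by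
  rw [phi_conjGL, cartan_apply, cartan_apply, cartanConj_apply, Matrix.mul_fin_two,
    Matrix.mul_fin_two]
  simp

lemma conjGL_mul_kerElt_cartan (ε : ZMod p) (u : ZMod p × ZMod p) :
    conjGL p * kerElt (cartan ε u) = kerElt (cartan ε (cartanConj p u)) * conjGL p :=
  mul_kerElt_of_eq _ (phi_conjGL_mul_cartan ε u)

lemma cartan_mem_kerSub_map_conjGL (ε : ZMod p) (H : Subgroup (GL2 (p^2))) (u : ZMod p × ZMod p) :
    cartan ε u ∈ kerSub (H.map (MulAut.conj (conjGL p)).toMonoidHom) ↔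
      cartan ε (cartanConj p u) ∈ kerSub H := by
  rw [mem_kerSub, mem_kerSub, mem_map_conj, conjGL_inv, conjGL_mul_kerElt_cartan, mul_assoc,
    conjGL_mul_self, mul_one]

lemma cartan_mem_or_of_isLocallyConjugate (hp : Odd p) {ε : ZMod p} (hε : ¬ IsSquare ε)
    {H₁ H₂ : Subgroup (GL2 (p^2))} {τ : GL2 (p^2)} (hτ₁ : τ ∈ H₁) (hτ₂ : τ ∈ H₂)
    (hτ : (τ ^ p) ^ p = τ) (hconj : conjGL p * τ * (conjGL p)⁻¹ = τ ^ p)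
    {w : ZMod p × ZMod p} (hw : (phi p τ).val = cartan ε w) (hw2 : w.2 ≠ 0)
    (h₂ : ∀ g ∈ H₂, ∃ u, (phi p g).val = cartan ε u) (h : IsLocallyConjugate H₁ H₂)
    {u : ZMod p × ZMod p} (hu : cartan ε u ∈ kerSub H₁) :
    cartan ε u ∈ kerSub H₂ ∨ cartan ε (cartanConj p u) ∈ kerSub H₂ := by
  have hε0 : ε ≠ 0 := by rintro rfl; exact hε (IsSquare.zero)
  have key {H : Subgroup (GL2 (p^2))} (hτH : τ ∈ H) {A : Matrix (Fin 2) (Fin 2) (ZMod p)}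
      (hA : A ∈ kerSub H) (hc : IsConj (τ * kerElt (cartan ε u)) (τ * kerElt A)) :
      cartan ε u ∈ kerSub H := by
    obtain ⟨h1, h2⟩ := trace_eq_of_isConj_mul_kerElt hc
    obtain ⟨u', v', rfl⟩ := exists_cartan_add_anticartan hp hε0 A
    have huu : u = u' := eq_of_trace_eq hp hε0 hw2 (v := 0) (v' := v')
      (by simpa using h1) (by simpa [hw] using h2)
    subst huu
    exact ((cartan_add_anticartan_mem hp hε hτH hw hw2 u v').1 hA).1
  obtain ⟨y, hy, hc⟩ := h.exists_isConj (H₁.mul_mem hτ₁ hu)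
  obtain ⟨v, hv⟩ := h₂ y hy
  have hphi : phi p (τ * kerElt (cartan ε u)) = phi p τ := by rw [map_mul, phi_kerElt, mul_one]
  rcases eq_or_eq_pow_of_isConj hp hε hw hv (hphi ▸ (phi p).map_isConj hc) with h1 | h1
  · obtain ⟨A, rfl⟩ := exists_eq_mul_kerElt h1
    exact Or.inl (key hτ₂ ((Subgroup.mul_mem_cancel_left _ hτ₂).1 hy) hc)
  · rw [← cartan_mem_kerSub_map_conjGL]
    have hτ' : τ ∈ H₂.map (MulAut.conj (conjGL p)).toMonoidHom := by
      rw [mem_map_conjGL, hconj]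
      exact pow_mem hτ₂ p
    have hy' : conjGL p * y * (conjGL p)⁻¹ ∈ H₂.map (MulAut.conj (conjGL p)).toMonoidHom :=
      ⟨y, hy, rfl⟩
    have hphi' : phi p (conjGL p * y * (conjGL p)⁻¹) = phi p τ := by
      rw [map_mul, map_mul, h1, ← map_pow, ← map_mul, ← map_mul, ← conj_pow, hconj, hτ]
    obtain ⟨A, hA⟩ := exists_eq_mul_kerElt hphi'
    rw [hA] at hy'
    refine Or.inr (key hτ' ((Subgroup.mul_mem_cancel_left _ hτ').1 hy') (hc.trans ?_))
    rw [← hA]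
    exact isConj_iff.2 ⟨_, rfl⟩

/-- Two locally conjugate groups containing a common lift of a nonscalar element of the nonsplit
Cartan group meet the kernel of reduction in the same Cartan part, after conjugating one of them. -/
lemma exists_conj_cartan_part_eq (hp : Odd p) {ε : ZMod p} (hε : ¬ IsSquare ε)
    {H₁ H₂ : Subgroup (GL2 (p^2))} {τ : GL2 (p^2)} (hτ₁ : τ ∈ H₁) (hτ₂ : τ ∈ H₂)
    (hτ : (τ ^ p) ^ p = τ) (hconj : conjGL p * τ * (conjGL p)⁻¹ = τ ^ p)
    {w : ZMod p × ZMod p} (hw : (phi p τ).val = cartan ε w) (hw2 : w.2 ≠ 0)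
    (h₁ : ∀ g ∈ H₁, ∃ u, (phi p g).val = cartan ε u)
    (h₂ : ∀ g ∈ H₂, ∃ u, (phi p g).val = cartan ε u) (h : IsLocallyConjugate H₁ H₂) :
    ∃ g, τ ∈ H₂.map (MulAut.conj g).toMonoidHom ∧
      (kerSub H₁).comap (cartan ε) =
        (kerSub (H₂.map (MulAut.conj g).toMonoidHom)).comap (cartan ε) := by
  have or_le {K₁ K₂ : Subgroup (GL2 (p^2))} (hτ₁ : τ ∈ K₁) (hτ₂ : τ ∈ K₂)
      (h₂ : ∀ g ∈ K₂, ∃ u, (phi p g).val = cartan ε u) (h : IsLocallyConjugate K₁ K₂) :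
      (kerSub K₁).comap (cartan ε) ≤ (kerSub K₂).comap (cartan ε) ∨
        (kerSub K₁).comap (cartan ε) ≤
          ((kerSub K₂).comap (cartan ε)).comap (cartanConj p).toLinearMap :=
    Submodule.le_or_le_of_forall_mem_or fun u hu =>
      cartan_mem_or_of_isLocallyConjugate hp hε hτ₁ hτ₂ hτ hconj hw hw2 h₂ h hu
  have card_le {K₁ K₂ : Subgroup (GL2 (p^2))} (hτ₁ : τ ∈ K₁) (hτ₂ : τ ∈ K₂)
      (h₂ : ∀ g ∈ K₂, ∃ u, (phi p g).val = cartan ε u) (h : IsLocallyConjugate K₁ K₂) :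
      Nat.card ((kerSub K₁).comap (cartan ε)) ≤ Nat.card ((kerSub K₂).comap (cartan ε)) := by
    rcases or_le hτ₁ hτ₂ h₂ h with h | h
    · exact Nat.card_le_card_of_injective _ (Submodule.inclusion_injective h)
    · exact Nat.card_le_card_of_injective (fun u => ⟨cartanConj p u, h u.2⟩) fun u v huv =>
        Subtype.ext ((cartanConj p).injective (congrArg Subtype.val huv))
  have eq_of_le {K₁ K₂ : Subgroup (GL2 (p^2))} (hτ₁ : τ ∈ K₁) (hτ₂ : τ ∈ K₂)
      (h₁ : ∀ g ∈ K₁, ∃ u, (phi p g).val = cartan ε u) (h : IsLocallyConjugate K₁ K₂)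
      (hle : (kerSub K₁).comap (cartan ε) ≤ (kerSub K₂).comap (cartan ε)) :
      (kerSub K₁).comap (cartan ε) = (kerSub K₂).comap (cartan ε) :=
    SetLike.coe_injective (Set.eq_of_subset_of_ncard_le hle (card_le hτ₂ hτ₁ h₁ h.symm))
  rcases or_le hτ₁ hτ₂ h₂ h with hle | hle
  · refine ⟨1, ?_⟩
    have h1 : H₂.map (MulAut.conj 1).toMonoidHom = H₂ := by
      ext x
      simp
    rw [h1]
    exact ⟨hτ₂, eq_of_le hτ₁ hτ₂ h₁ h hle⟩
  · have hτ' : τ ∈ H₂.map (MulAut.conj (conjGL p)).toMonoidHom := by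
      rw [mem_map_conjGL, hconj]
      exact pow_mem hτ₂ p
    exact ⟨conjGL p, hτ', eq_of_le hτ₁ hτ' h₁ (h.trans (isLocallyConjugate_map_conj _ _))
      fun u hu => (cartan_mem_kerSub_map_conjGL ε H₂ u).2 (hle hu)⟩

lemma isConjugateSubgroup_of_cartan_part_eq (hp : Odd p) {ε : ZMod p} (hε : ¬ IsSquare ε)
    {H₁ H₂ : Subgroup (GL2 (p^2))} {τ : GL2 (p^2)} (hτ₁ : τ ∈ H₁) (hτ₂ : τ ∈ H₂)
    {w : ZMod p × ZMod p} (hw : (phi p τ).val = cartan ε w) (hw2 : w.2 ≠ 0)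
    (hcomm : ∀ (b : GL2 p) (u : ZMod p × ZMod p), b.val = cartan ε u →
      ∃ x, phi p x = b ∧ Commute x τ)
    (hgen : ∀ g ∈ H₁, phi p g ∈ Subgroup.zpowers (phi p τ)) (h : IsLocallyConjugate H₁ H₂)
    (hcartan : (kerSub H₁).comap (cartan ε) = (kerSub H₂).comap (cartan ε)) :
    IsConjugateSubgroup H₁ H₂ := by
  have hε0 : ε ≠ 0 := by rintro rfl; exact hε (IsSquare.zero)
  have hcard : Nat.card ((kerSub H₁).comap (anticartan ε)) =
      Nat.card ((kerSub H₂).comap (anticartan ε)) := by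
    have h1 := card_kerSub_eq h
    rw [card_kerSub hp hε hτ₁ hw hw2, card_kerSub hp hε hτ₂ hw hw2, hcartan] at h1
    exact Nat.eq_of_mul_eq_mul_left Nat.card_pos h1
  obtain ⟨u, hu, huW⟩ := exists_cartan_conj hp hε _ _ hcard fun a ha b hb ha0 hb0 hb' ha' =>
    isSquare_norm_mul_norm hp hε (kerSub H₁) (kerSub H₂)
      (fun u v h => ((cartan_add_anticartan_mem hp hε hτ₁ hw hw2 u v).1 h).2)
      (fun u v h => ((cartan_add_anticartan_mem hp hε hτ₂ hw hw2 u v).1 h).2)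
      (fun u => SetLike.ext_iff.1 hcartan u)
      (fun A hA => exists_mem_kerSub_of_isLocallyConjugate h hA)
      (fun A hA => exists_mem_kerSub_of_isLocallyConjugate h.symm hA)
      ha hb ha0 hb0 hb' ha'
  obtain ⟨x, hx, hxτ⟩ := hcomm (Matrix.GeneralLinearGroup.mkOfDetNeZero (cartan ε u)
    (by rw [det_cartan]; exact cartanNorm_ne_zero hε hu)) u rfl
  have hxu : (phi p x).val = cartan ε u := congrArg Units.val hx
  have hker {A : Matrix (Fin 2) (Fin 2) (ZMod p)} (hA : A ∈ kerSub H₁) :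
      x * kerElt A * x⁻¹ ∈ H₂ := by
    obtain ⟨a, v, rfl⟩ := exists_cartan_add_anticartan hp hε0 A
    obtain ⟨ha, hv⟩ := (cartan_add_anticartan_mem hp hε hτ₁ hw hw2 a v).1 hA
    obtain ⟨v', hv', hvv⟩ := huW v hv
    have h1 : x * kerElt (cartan ε a + anticartan ε v) =
        kerElt (cartan ε a + anticartan ε v') * x := by
      apply mul_kerElt_of_eq
      rw [hxu, mul_add, add_mul, hvv, cartan_mul_comm]
    rw [h1, mul_inv_cancel_right]
    have ha' : cartan ε a ∈ kerSub H₂ := (SetLike.ext_iff.1 hcartan a).1 ha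
    have hv'' : anticartan ε v' ∈ kerSub H₂ := hv'
    exact mem_kerSub.1 (add_mem ha' hv'')
  refine ⟨x, Subgroup.eq_of_le_of_card_ge ?_ ?_⟩
  · rintro _ ⟨y, hy, rfl⟩
    obtain ⟨k, hk⟩ := Subgroup.mem_zpowers_iff.1 (hgen y hy)
    rw [← map_zpow] at hk
    obtain ⟨A, rfl⟩ := exists_eq_mul_kerElt hk.symm
    have hA : A ∈ kerSub H₁ := (Subgroup.mul_mem_cancel_left _ (zpow_mem hτ₁ k)).1 hy
    have h1 : x * (τ ^ k * kerElt A) * x⁻¹ = τ ^ k * (x * kerElt A * x⁻¹) := by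
      rw [← mul_assoc, (hxτ.zpow_right k).eq]
      simp only [mul_assoc]
    change x * (τ ^ k * kerElt A) * x⁻¹ ∈ H₂
    rw [h1]
    exact H₂.mul_mem (zpow_mem hτ₂ k) (hker hA)
  · rw [← h.card_eq, (isLocallyConjugate_map_conj H₁ x).card_eq]

end Conjugacy

/-- (The nonsplit Cartan case.) Let `ε ∈ ℤ/pℤ` be a nonsquare.
If every element of each `φ(Hᵢ)` has the form `!![w, εy; y, w]`, and each `φ(Hᵢ)`
contains such an element with `y ≠ 0`, then local conjugacy of `H₁` and `H₂` in
`GL₂(ℤ/p²ℤ)` implies conjugacy in `GL₂(ℤ/p²ℤ)`. -/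
theorem nonsplit_cartan_case {p : ℕ} [Fact p.Prime] (hp : Odd p)
    (ε : ZMod p) (hε : ¬ IsSquare ε)
    (H₁ H₂ : Subgroup (GL2 (p^2)))
    (hform₁ : ∀ g ∈ H₁, ∃ w y : ZMod p,
      (↑(phi p g) : Matrix (Fin 2) (Fin 2) (ZMod p)) = !![w, ε * y; y, w])
    (hnz₁ : ∃ g ∈ H₁, ∃ w y : ZMod p, y ≠ 0 ∧
      (↑(phi p g) : Matrix (Fin 2) (Fin 2) (ZMod p)) = !![w, ε * y; y, w])
    (hform₂ : ∀ g ∈ H₂, ∃ w y : ZMod p,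
      (↑(phi p g) : Matrix (Fin 2) (Fin 2) (ZMod p)) = !![w, ε * y; y, w])
    (hnz₂ : ∃ g ∈ H₂, ∃ w y : ZMod p, y ≠ 0 ∧
      (↑(phi p g) : Matrix (Fin 2) (Fin 2) (ZMod p)) = !![w, ε * y; y, w])
    (h : IsLocallyConjugate H₁ H₂) :
    IsConjugateSubgroup H₁ H₂ := by
  have hc₁ : ∀ g ∈ H₁, ∃ u, (phi p g).val = cartan ε u := fun g hg => by
    obtain ⟨w, y, hwy⟩ := hform₁ g hg
    exact ⟨(w, y), hwy⟩
  have hc₂ : ∀ g ∈ H₂, ∃ u, (phi p g).val = cartan ε u := fun g hg => by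
    obtain ⟨w, y, hwy⟩ := hform₂ g hg
    exact ⟨(w, y), hwy⟩
  obtain ⟨_, ⟨g₁, hg₁, rfl⟩, hgen⟩ := exists_generator_of_cartan hε (H₁.map (phi p))
    (by rintro _ ⟨g, hg, rfl⟩; exact hc₁ g hg)
  obtain ⟨w, hw⟩ := hc₁ g₁ hg₁
  have hw2 : w.2 ≠ 0 := by
    intro h0
    have hscalar : (phi p g₁).val = Matrix.scalar (Fin 2) w.1 := by
      rw [hw, cartan_apply, h0]
      ext i j
      fin_cases i <;> fin_cases j <;> simp
    have hcenter : phi p g₁ ∈ Subgroup.center (GL2 p) := by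
      rw [Subgroup.mem_center_iff]
      intro x
      refine Units.ext ?_
      rw [Units.val_mul, Units.val_mul, hscalar]
      exact ((Matrix.scalar_commute w.1 (fun r => mul_comm _ _) x.val).eq).symm
    obtain ⟨g, hg, a, y, hy, hgy⟩ := hnz₁
    have hg' : phi p g ∈ Subgroup.center (GL2 p) :=
      (Subgroup.zpowers_le.2 hcenter) (hgen _ ⟨g, hg, rfl⟩)
    have h1 := congrArg Units.val (Subgroup.mem_center_iff.1 hg' (phi p (conjGL p)))
    rw [Units.val_mul, Units.val_mul, phi_conjGL, hgy, Matrix.mul_fin_two,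
      Matrix.mul_fin_two] at h1
    have h2 : -y = y := by simpa using congrFun (congrFun h1 1) 0
    exact mul_ne_zero (two_ne_zero_of_odd hp) hy (by linear_combination -h2)
  obtain ⟨τ, hτg, hτ, hconj, hcomm, hlift⟩ := exists_multiplicative_lift hp hε hw hw2
  rw [← hτg] at hw hgen
  obtain ⟨g₂, hg₂, hg₂₁⟩ := map_phi_le hp hε hc₁ hc₂ h ⟨g₁, hg₁, rfl⟩
  obtain ⟨A₁, hA₁⟩ := hlift g₁ rfl
  obtain ⟨A₂, hA₂⟩ := hlift g₂ hg₂₁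
  have hmem {K : Subgroup (GL2 (p^2))} {A : Matrix (Fin 2) (Fin 2) (ZMod p)} {g : GL2 (p^2)}
      (hg : g ∈ K) (hA : ((kerElt A * g * (kerElt A)⁻¹) ^ p) ^ p = τ) :
      τ ∈ K.map (MulAut.conj (kerElt A)).toMonoidHom := by
    rw [← hA]
    exact pow_mem (pow_mem (Subgroup.mem_map_of_mem _ hg) p) p
  have hphi {K : Subgroup (GL2 (p^2))} {A : Matrix (Fin 2) (Fin 2) (ZMod p)} {g : GL2 (p^2)}
      (hg : g ∈ K.map (MulAut.conj (kerElt A)).toMonoidHom) : ∃ g' ∈ K, phi p g = phi p g' := by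
    obtain ⟨g', hg', rfl⟩ := hg
    exact ⟨g', hg', by simp⟩
  have hloc := ((isLocallyConjugate_map_conj H₁ (kerElt A₁)).symm.trans h).trans
    (isLocallyConjugate_map_conj H₂ (kerElt A₂))
  obtain ⟨c, hτc, hcartan⟩ := exists_conj_cartan_part_eq hp hε (hmem hg₁ hA₁) (hmem hg₂ hA₂) hτ
    hconj hw hw2
    (fun g hg => by
      obtain ⟨g', hg', hgg⟩ := hphi hg
      exact hgg ▸ hc₁ g' hg')
    (fun g hg => by
      obtain ⟨g', hg', hgg⟩ := hphi hg
      exact hgg ▸ hc₂ g' hg') hloc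
  have hcore := isConjugateSubgroup_of_cartan_part_eq hp hε (hmem hg₁ hA₁) hτc hw hw2 hcomm
    (fun g hg => by
      obtain ⟨g', hg', hgg⟩ := hphi hg
      exact hgg ▸ hgen _ ⟨g', hg', rfl⟩)
    (hloc.trans (isLocallyConjugate_map_conj _ c)) hcartan
  exact (((isConjugateSubgroup_map_conj H₁ _).trans hcore).trans
    (isConjugateSubgroup_map_conj _ c).symm).trans (isConjugateSubgroup_map_conj H₂ _).symm
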